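/- Let D ≥ 2 and let G be a bipartite (D+1)-colored graph with p ≥ 2 black vertices. Let b ∈ B and w := σ_0(b), and assume that b and σ_1⁻¹(w) lie in different orbits of the subgroup H generated by {σ_k⁻¹ ∘ σ_j : j, k ≠ 0} (i.e., the two endpoints of the color-0 edge (b, w) belong to different D-bubbles of colors 0̂). Let G' be the contracted graph: B' = B ∖ {b}, W' = W ∖ {w}, σ'_0 the restriction of σ_0, and for j ≠ 0, σ'_j(x) = σ_j(x) if σ_j(x) ≠ w and σ'_j(x) = σ_j(b) if σ_j(x) = w. Then for every cyclic permutation τ of {0,…,D} the jacket face numbers satisfy F_{J'(τ)} = F_{J(τ)} − (D−1), so that the Euler characteristic of every jacket is unchanged: 2(p−1) − (D+1)(p−1) + F_{J'(τ)} = 2p − (D+1)p + F_{J(τ)}; moreover the total face numbers satisfy F_{G'} = F_G − D(D−1)/2. -/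

import Mathlib

/-- A cyclic permutation of a finite set: a permutation with a single cycle
covering all of the set. -/
def IsFullCycle {α : Type*} [Fintype α] [DecidableEq α] (τ : Equiv.Perm α) : Prop :=
  τ.IsCycle ∧ τ.support = Finset.univ

noncomputable section
/-- The cycle (orbit) of `π` through `b`, as a set. -/
def cycleSet {B : Type*} (π : Equiv.Perm B) (b : B) : Set B :=
  {x | π.SameCycle b x}

/-- The cycles of `π` passing through the set `s` (for a `π`-invariant `s`, these are
the cycles of the restriction of `π` to `s`). -/
def cyclesIn {B : Type*} (π : Equiv.Perm B) (s : Set B) : Set (Set B) :=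
  {t | ∃ b ∈ s, t = cycleSet π b}

/-- The number of cycles of `π` passing through `s`. -/
def numCyclesIn {B : Type*} (π : Equiv.Perm B) (s : Set B) : ℕ :=
  Nat.card (cyclesIn π s)

/-- The number of cycles (orbits, including fixed points) of `π`. -/
def numCycles {B : Type*} (π : Equiv.Perm B) : ℕ :=
  numCyclesIn π Set.univ

/-- A bipartite `(D+1)`-colored graph on black vertices `B` and white vertices `W`
is a family `σ : Fin (D+1) → B ≃ W` of bijections (the edges of each color).
`facePerm σ i j = σ_j⁻¹ ∘ σ_i` is the permutation of `B` whose cycles are the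
faces of colors `{i, j}`. -/
def facePerm {D : ℕ} {B W : Type*} (σ : Fin (D + 1) → B ≃ W) (i j : Fin (D + 1)) :
    Equiv.Perm B :=
  (σ i).trans (σ j).symm

/-- The number of faces of the jacket associated to a cyclic permutation `τ` of the
colors: the faces of colors `{c, τ c}` for all colors `c`. -/
def jacketFaces {D : ℕ} {B W : Type*} (σ : Fin (D + 1) → B ≃ W)
    (τ : Equiv.Perm (Fin (D + 1))) : ℕ :=
  ∑ c : Fin (D + 1), numCycles (facePerm σ c (τ c))

/-- The total number of faces of the graph, over all unordered pairs of distinct colors. -/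
def totalFaces {D : ℕ} {B W : Type*} (σ : Fin (D + 1) → B ≃ W) : ℕ :=
  ∑ p ∈ Finset.univ.filter (fun p : Fin (D + 1) × Fin (D + 1) => p.1 < p.2),
    numCycles (facePerm σ p.1 p.2)

/-- The subgroup of permutations of `B` generated by all `σ_j⁻¹ ∘ σ_i`. -/
def colorGroup {D : ℕ} {B W : Type*} (σ : Fin (D + 1) → B ≃ W) : Subgroup (Equiv.Perm B) :=
  Subgroup.closure {π | ∃ i j, π = facePerm σ i j}

/-- The graph is connected iff the group generated by the `σ_j⁻¹ ∘ σ_i` acts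
transitively on `B`. -/
def IsConnectedGraph {D : ℕ} {B W : Type*} (σ : Fin (D + 1) → B ≃ W) : Prop :=
  ∀ b b' : B, ∃ g ∈ colorGroup σ, g b = b'

/-- The subgroup generated by the `σ_k⁻¹ ∘ σ_j` with `j, k ≠ i`. -/
def bubbleGroup {D : ℕ} {B W : Type*} (σ : Fin (D + 1) → B ≃ W) (i : Fin (D + 1)) :
    Subgroup (Equiv.Perm B) :=
  Subgroup.closure {π | ∃ j k, j ≠ i ∧ k ≠ i ∧ π = facePerm σ j k}

/-- The `D`-bubble of colors `î` containing the black vertex `b`: its orbit under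
`bubbleGroup σ i`. -/
def bubbleOf {D : ℕ} {B W : Type*} (σ : Fin (D + 1) → B ≃ W) (i : Fin (D + 1)) (b : B) :
    Set B :=
  {x | ∃ g ∈ bubbleGroup σ i, g b = x}

/-- The set of `D`-bubbles of colors `î` of the graph. -/
def bubbles {D : ℕ} {B W : Type*} (σ : Fin (D + 1) → B ≃ W) (i : Fin (D + 1)) :
    Set (Set B) :=
  {s | ∃ b, s = bubbleOf σ i b}

/-- The cycle relation of `π` is contained in every equivalence relation that relates
each point to its image under `π`. -/
theorem sameCycle_of_forall_rel {α : Type*} {π : Equiv.Perm α} {r : α → α → Prop}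
    (hr : Equivalence r) (h : ∀ x, r x (π x)) {x y : α} (hxy : π.SameCycle x y) : r x y := by
  obtain ⟨n, rfl⟩ := hxy
  induction n using Int.induction_on with
  | zero => exact hr.refl _
  | succ n ih =>
    rw [add_comm, zpow_add, zpow_one, Equiv.Perm.mul_apply]
    exact hr.trans ih (h _)
  | pred n ih =>
    refine hr.trans ih (hr.symm ?_)
    have := h ((π ^ (-(n : ℤ) - 1)) x)
    rwa [← Equiv.Perm.mul_apply, ← zpow_one_add, add_sub_cancel] at this

theorem sameCycle_equivalence {α : Type*} (π : Equiv.Perm α) : Equivalence π.SameCycle :=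
  ⟨Equiv.Perm.SameCycle.refl π, Equiv.Perm.SameCycle.symm, Equiv.Perm.SameCycle.trans⟩

theorem numCycles_eq_card_quotient {α : Type*} (π : Equiv.Perm α) :
    numCycles π = Nat.card (Quotient (Equiv.Perm.SameCycle.setoid π)) := by
  symm
  refine Nat.card_congr (Equiv.ofBijective
    (Quotient.lift (fun x => (⟨cycleSet π x, x, Set.mem_univ x, rfl⟩ : cyclesIn π Set.univ))
      ?_) ⟨?_, ?_⟩)
  · intro x y (hxy : π.SameCycle x y)
    refine Subtype.ext (Set.ext fun z => ?_)
    exact ⟨fun h => hxy.symm.trans h, fun h => hxy.trans h⟩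
  · rintro ⟨x⟩ ⟨y⟩ h
    have h' : cycleSet π x = cycleSet π y := congrArg Subtype.val h
    have hy : y ∈ cycleSet π x := h' ▸ Equiv.Perm.SameCycle.refl π y
    exact Quotient.sound hy
  · rintro ⟨t, x, hx, rfl⟩
    exact ⟨Quotient.mk _ x, rfl⟩

theorem numCycles_inv {α : Type*} (π : Equiv.Perm α) : numCycles π⁻¹ = numCycles π := by
  have h : cycleSet π⁻¹ = cycleSet π := by
    ext x y
    exact Equiv.Perm.sameCycle_inv
  simp only [numCycles, numCyclesIn, cyclesIn, h]

/-- Removing a non-fixed point from its cycle does not change the number of cycles. -/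
theorem numCycles_skip {α : Type*} [DecidableEq α] (π : Equiv.Perm α) (b : α) (hb : π b ≠ b)
    (π' : Equiv.Perm {x : α // x ≠ b})
    (h : ∀ x, (π' x : α) = if π x = b then π b else π x) :
    numCycles π' = numCycles π := by
  rw [numCycles_eq_card_quotient, numCycles_eq_card_quotient]
  let f : α → {x : α // x ≠ b} := fun x => if hx : x = b then ⟨π b, hb⟩ else ⟨x, hx⟩
  have hf : ∀ x : {x : α // x ≠ b}, f x = x := fun x => dif_neg x.2
  have hval : ∀ x y, π'.SameCycle x y → π.SameCycle (x : α) y := fun x y hxy =>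
    sameCycle_of_forall_rel (r := fun x y : {x : α // x ≠ b} => π.SameCycle (x : α) y)
      ((sameCycle_equivalence π).comap _) (fun x => by
        rw [h]
        split_ifs with hx
        · exact ⟨2, by rw [zpow_ofNat, pow_two, Equiv.Perm.mul_apply, hx]⟩
        · exact ⟨1, rfl⟩) hxy
  have hfc : ∀ x y, π.SameCycle x y → π'.SameCycle (f x) (f y) := fun x y hxy =>
    sameCycle_of_forall_rel (r := fun x y => π'.SameCycle (f x) (f y))
      ((sameCycle_equivalence π').comap _) (fun x => by
        by_cases hx : x = b
        · subst hx
          have : f x = f (π x) := by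
            simp [f, hb]
          rw [this]
        · have : f (π x) = π' (f x) := by
            apply Subtype.ext
            rw [h]
            by_cases hπ : π x = b <;> simp [f, hx, hπ]
          rw [this]
          exact ⟨1, rfl⟩) hxy
  refine Nat.card_congr ⟨Quotient.map' Subtype.val hval, Quotient.map' f hfc, ?_, ?_⟩
  · rintro ⟨x⟩
    exact congrArg (Quotient.mk _) (hf x)
  · rintro ⟨x⟩
    refine Quotient.sound (show π.SameCycle (f x : α) x from ?_)
    by_cases hx : x = b
    · subst hx
      simpa [f] using Equiv.Perm.SameCycle.symm (⟨1, rfl⟩ : π.SameCycle x (π x))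
    · simp only [f, hx, dite_false]
      exact Equiv.Perm.SameCycle.refl _ _

/-- Composing with the transposition of two points on different cycles merges these cycles. -/
theorem numCycles_mul_swap {α : Type*} [Finite α] [DecidableEq α] (π : Equiv.Perm α) (a b : α)
    (hab : ¬ π.SameCycle a b) : numCycles (π * Equiv.swap a b) + 1 = numCycles π := by
  rw [numCycles_eq_card_quotient, numCycles_eq_card_quotient]
  set ρ := π * Equiv.swap a b with hρ
  have ha : ρ a = π b := by simp [hρ]
  have hb : ρ b = π a := by simp [hρ]
  have hne : ∀ x, x ≠ a → x ≠ b → ρ x = π x := fun x h₁ h₂ => by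
    simp [hρ, Equiv.swap_apply_of_ne_of_ne h₁ h₂]
  have step : ∀ x, ρ.SameCycle x (ρ x) := fun x => ⟨1, rfl⟩
  have hstep : ∀ x, π.SameCycle x (π x) := fun x => ⟨1, rfl⟩
  have hρab : ρ.SameCycle a b := by
    by_contra hcon
    have key : ∀ k : ℕ, ρ.SameCycle a ((π ^ (k + 1)) b) := by
      intro k
      induction k with
      | zero => simpa [ha] using step a
      | succ k ih =>
        rw [pow_succ', Equiv.Perm.mul_apply, ← hne ((π ^ (k + 1)) b)]
        · exact ih.trans (step _)
        · intro h
          exact hab (Equiv.Perm.SameCycle.symm ⟨(k + 1 : ℕ), by rw [zpow_natCast, h]⟩)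
        · intro h
          exact hcon (by rwa [h] at ih)
    have hk := key (orderOf π - 1)
    rw [Nat.sub_add_cancel (orderOf_pos π), pow_orderOf_eq_one] at hk
    exact hcon hk
  have hle : ∀ x y, π.SameCycle x y → ρ.SameCycle x y := fun x y hxy =>
    sameCycle_of_forall_rel (sameCycle_equivalence ρ) (fun x => by
      by_cases h₁ : x = a
      · subst h₁
        rw [← hb]
        exact hρab.trans (step b)
      · by_cases h₂ : x = b
        · subst h₂
          rw [← ha]
          exact hρab.symm.trans (step a)
        · rw [← hne x h₁ h₂]
          exact step x) hxy
  let g : α → α → Prop := fun x y =>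
    (π.SameCycle a x ∨ π.SameCycle b x) ∧ (π.SameCycle a y ∨ π.SameCycle b y)
  have hmerge : ∀ x y, ρ.SameCycle x y → π.SameCycle x y ∨ g x y := fun x y hxy =>
    sameCycle_of_forall_rel (r := fun x y => π.SameCycle x y ∨ g x y)
      ⟨fun x => .inl (.refl _ _),
        fun h => h.imp (·.symm) (·.symm),
        by
          rintro x y z (h | ⟨hx, hy⟩) (h' | ⟨hy', hz⟩)
          · exact .inl (h.trans h')
          · exact .inr ⟨hy'.imp (·.trans h.symm) (·.trans h.symm), hz⟩
          · exact .inr ⟨hx, hy.imp (·.trans h') (·.trans h')⟩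
          · exact .inr ⟨hx, hz⟩⟩
      (fun x => by
        by_cases h₁ : x = a
        · subst h₁
          rw [ha]
          exact .inr ⟨.inl (.refl _ _), .inr (hstep b)⟩
        · by_cases h₂ : x = b
          · subst h₂
            rw [hb]
            exact .inr ⟨.inr (.refl _ _), .inl (hstep a)⟩
          · rw [hne x h₁ h₂]
            exact .inl (hstep x)) hxy
  let q : Quotient (Equiv.Perm.SameCycle.setoid π) := Quotient.mk _ a
  have hcard : Nat.card {t : Quotient (Equiv.Perm.SameCycle.setoid π) // t ≠ q} =
      Nat.card (Quotient (Equiv.Perm.SameCycle.setoid ρ)) := by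
    refine Nat.card_congr (Equiv.ofBijective
      (fun t => Quotient.map' (s₂ := Equiv.Perm.SameCycle.setoid ρ) id hle t.1) ⟨?_, ?_⟩)
    · rintro ⟨⟨x⟩, hx⟩ ⟨⟨y⟩, hy⟩ h
      have hxa : ¬ π.SameCycle a x := fun h' => hx (Quotient.sound h'.symm)
      have hya : ¬ π.SameCycle a y := fun h' => hy (Quotient.sound h'.symm)
      refine Subtype.ext (Quotient.sound (show π.SameCycle x y from ?_))
      have hxy : ρ.SameCycle x y := Quotient.exact h
      rcases hmerge x y hxy with h' | ⟨h₁, h₂⟩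
      · exact h'
      · exact (h₁.resolve_left hxa).symm.trans (h₂.resolve_left hya)
    · rintro ⟨y⟩
      by_cases hy : π.SameCycle a y
      · refine ⟨⟨Quotient.mk _ b, fun h => hab ?_⟩, Quotient.sound ?_⟩
        · exact Equiv.Perm.SameCycle.symm (Quotient.exact h)
        · exact hρab.symm.trans (hle _ _ hy)
      · exact ⟨⟨Quotient.mk _ y, fun h => hy (Equiv.Perm.SameCycle.symm (Quotient.exact h))⟩, rfl⟩
  rw [← hcard, ← Finite.card_option]
  classical
  exact Nat.card_congr (Equiv.optionSubtypeNe q)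

theorem numCycles_facePerm_comm {D : ℕ} {B W : Type*} (σ : Fin (D + 1) → B ≃ W)
    (i j : Fin (D + 1)) : numCycles (facePerm σ i j) = numCycles (facePerm σ j i) :=
  numCycles_inv (facePerm σ j i)

theorem card_filter_fst_lt_snd (n : ℕ) :
    (Finset.univ.filter (fun p : Fin n × Fin n => p.1 < p.2)).card = n * (n - 1) / 2 := by
  have h : ∀ n : ℕ, ∑ i : Fin n, ∑ j : Fin n, (if i < j then 1 else 0) = n.choose 2 := by
    intro n
    induction n with
    | zero => rfl
    | succ n ih =>
      rw [Fin.sum_univ_succ, Nat.choose_succ_succ, Nat.choose_one_right, ← ih]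
      simp only [Fin.sum_univ_succ (n := n), Fin.succ_lt_succ_iff, Fin.succ_pos,
        Fin.not_lt_zero, if_true, if_false, zero_add, Finset.sum_const, Finset.card_univ,
        Fintype.card_fin, smul_eq_mul, mul_one, lt_irrefl]
  rw [Finset.card_filter, ← Nat.choose_two_right, ← h n, Fintype.sum_prod_type]

theorem card_filter_pos_lt (n : ℕ) :
    ∑ p ∈ Finset.univ.filter (fun p : Fin (n + 1) × Fin (n + 1) => p.1 < p.2),
      (if p.1 = 0 ∨ p.2 = 0 then 0 else 1) = n * (n - 1) / 2 := by
  rw [← card_filter_fst_lt_snd, Finset.card_filter, Finset.sum_filter, Fintype.sum_prod_type,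
    Fintype.sum_prod_type]
  simp [Fin.sum_univ_succ, Fin.succ_ne_zero]

theorem sum_ite_fixedPointFree {D : ℕ} {τ : Equiv.Perm (Fin (D + 1))} (hτ : τ 0 ≠ 0) :
    ∑ c : Fin (D + 1), (if c = 0 ∨ τ c = 0 then 0 else 1) + 2 = D + 1 := by
  have h : (Finset.univ.filter (fun c => c = 0 ∨ τ c = 0)) = {0, τ.symm 0} := by
    ext c
    simp [Equiv.eq_symm_apply]
  have h0 : (0 : Fin (D + 1)) ≠ τ.symm 0 := fun h => hτ (by
    conv_lhs => rw [h]
    simp)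
  have hc := Finset.card_filter_add_card_filter_not (s := (Finset.univ : Finset (Fin (D + 1))))
    (fun c => c = 0 ∨ τ c = 0)
  rw [h, Finset.card_pair h0, Finset.card_univ, Fintype.card_fin] at hc
  simpa only [Finset.card_filter, ite_not, add_comm] using hc

/-- Contracting a 1-dipole of color `0` keeps the number of faces of colors `{0, j}`. -/
theorem numCycles_facePerm_zero_of_contraction {D : ℕ} {B W : Type*} [DecidableEq B]
    [DecidableEq W] (σ : Fin (D + 1) → B ≃ W) (b : B)
    (σ' : Fin (D + 1) → ({x : B // x ≠ b} ≃ {y : W // y ≠ σ 0 b}))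
    (hσ'0 : ∀ x : {x : B // x ≠ b}, ((σ' 0 x : W) = σ 0 (x : B)))
    (hσ'j : ∀ j : Fin (D + 1), j ≠ 0 → ∀ x : {x : B // x ≠ b},
      ((σ' j x : W) = if σ j (x : B) = σ 0 b then σ j b else σ j (x : B)))
    {j : Fin (D + 1)} (hj : j ≠ 0) (hbj : (σ j).symm (σ 0 b) ≠ b) :
    numCycles (facePerm σ' 0 j) = numCycles (facePerm σ 0 j) := by
  refine numCycles_skip _ b hbj _ fun x => ?_
  have hy : (if facePerm σ 0 j x = b then facePerm σ 0 j b else facePerm σ 0 j x) ≠ b := by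
    split_ifs with h
    exacts [hbj, h]
  suffices facePerm σ' 0 j x = ⟨_, hy⟩ from congrArg Subtype.val this
  refine (Equiv.symm_apply_eq _).2 (Subtype.ext ?_)
  rw [hσ'0, hσ'j j hj]
  by_cases h : facePerm σ 0 j x = b
  · simp only [if_pos h]
    have hx : σ j b = σ 0 x :=
      (congrArg (σ j) h).symm.trans (by simp [facePerm])
    rw [hx]
    simp [facePerm]
  · simp only [if_neg h]
    simp [facePerm, x.2]

/-- Contracting a 1-dipole of color `0` merges two faces of colors `{i, j}`, for
`i, j ≠ 0`. -/
theorem numCycles_facePerm_ne_zero_of_contraction {D : ℕ} {B W : Type*} [Finite B]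
    [DecidableEq B] [DecidableEq W] (σ : Fin (D + 1) → B ≃ W) (b : B)
    (σ' : Fin (D + 1) → ({x : B // x ≠ b} ≃ {y : W // y ≠ σ 0 b}))
    (hσ'j : ∀ j : Fin (D + 1), j ≠ 0 → ∀ x : {x : B // x ≠ b},
      ((σ' j x : W) = if σ j (x : B) = σ 0 b then σ j b else σ j (x : B)))
    {i j : Fin (D + 1)} (hi : i ≠ 0) (hj : j ≠ 0) (hbj : (σ j).symm (σ 0 b) ≠ b)
    (hij : ¬ (facePerm σ i j).SameCycle ((σ i).symm (σ 0 b)) b) :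
    numCycles (facePerm σ' i j) + 1 = numCycles (facePerm σ i j) := by
  rw [← numCycles_mul_swap _ _ _ hij]
  set a := (σ i).symm (σ 0 b) with ha
  have hai : σ i a = σ 0 b := by simp [ha]
  have hba : b ≠ a := fun h => hij (by rw [← h])
  have hib : σ i b ≠ σ 0 b := fun h => hba ((σ i).injective (h.trans hai.symm))
  set ρ := facePerm σ i j * Equiv.swap a b with hρ
  have hρb : ρ b = (σ j).symm (σ 0 b) := by simp [hρ, facePerm, hai]
  have hb : ρ b ≠ b := hρb ▸ hbj
  congr 1
  refine numCycles_skip _ b hb _ fun x => ?_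
  have hy : (if ρ x = b then ρ b else ρ x) ≠ b := by
    split_ifs with h
    exacts [hb, h]
  suffices facePerm σ' i j x = ⟨_, hy⟩ from congrArg Subtype.val this
  refine (Equiv.symm_apply_eq _).2 (Subtype.ext ?_)
  have hρx : σ j (ρ x) = σ' i x := by
    rw [hσ'j i hi]
    by_cases hx : (x : B) = a
    · simp [hρ, hx, hai, facePerm]
    · have : σ i x ≠ σ 0 b := fun h => hx ((σ i).injective (h.trans hai.symm))
      simp [hρ, Equiv.swap_apply_of_ne_of_ne hx x.2, facePerm, this]
  rw [hσ'j j hj, ← hρx]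
  by_cases h : ρ x = b
  · simp only [if_pos h]
    rw [hρb, h]
    simp
  · simp only [if_neg h]
    rw [if_neg]
    rw [hρx]
    exact (σ' i x).2

/-- The number of faces of colors `{i, j}` before and after contracting a 1-dipole of
color `0`. -/
theorem numCycles_facePerm_of_contraction {D : ℕ} (hD : 2 ≤ D) {B W : Type*} [Finite B]
    [DecidableEq B] [DecidableEq W] (σ : Fin (D + 1) → B ≃ W) (b : B)
    (hdipole : ¬ ∃ g ∈ bubbleGroup σ 0, g b = (σ 1).symm (σ 0 b))
    (σ' : Fin (D + 1) → ({x : B // x ≠ b} ≃ {y : W // y ≠ σ 0 b}))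
    (hσ'0 : ∀ x : {x : B // x ≠ b}, ((σ' 0 x : W) = σ 0 (x : B)))
    (hσ'j : ∀ j : Fin (D + 1), j ≠ 0 → ∀ x : {x : B // x ≠ b},
      ((σ' j x : W) = if σ j (x : B) = σ 0 b then σ j b else σ j (x : B)))
    {i j : Fin (D + 1)} (hne : i ≠ j) :
    numCycles (facePerm σ' i j) + (if i = 0 ∨ j = 0 then 0 else 1) =
      numCycles (facePerm σ i j) := by
  have h10 : (1 : Fin (D + 1)) ≠ 0 := by
    obtain ⟨d, rfl⟩ : ∃ d, D = d + 1 := ⟨D - 1, by omega⟩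
    exact one_ne_zero
  have horbit : ∀ k : Fin (D + 1), k ≠ 0 → ∀ g ∈ bubbleGroup σ 0,
      g b ≠ (σ k).symm (σ 0 b) := fun k hk g hg h => by
    refine hdipole ⟨facePerm σ k 1 * g, mul_mem (Subgroup.subset_closure
      ⟨k, 1, hk, h10, rfl⟩) hg, ?_⟩
    simp [Equiv.Perm.mul_apply, h, facePerm]
  have hbk : ∀ k : Fin (D + 1), k ≠ 0 → (σ k).symm (σ 0 b) ≠ b := fun k hk h =>
    horbit k hk 1 (one_mem _) h.symm
  by_cases hi : i = 0
  · subst hi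
    simpa using
      numCycles_facePerm_zero_of_contraction σ b σ' hσ'0 hσ'j hne.symm (hbk j hne.symm)
  by_cases hj : j = 0
  · subst hj
    rw [numCycles_facePerm_comm σ', numCycles_facePerm_comm σ]
    simpa using numCycles_facePerm_zero_of_contraction σ b σ' hσ'0 hσ'j hi (hbk i hi)
  rw [if_neg (by tauto)]
  refine numCycles_facePerm_ne_zero_of_contraction σ b σ' hσ'j hi hj (hbk j hj) fun h => ?_
  obtain ⟨n, hn⟩ := h.symm
  have hmem : facePerm σ i j ∈ bubbleGroup σ 0 :=
    Subgroup.subset_closure ⟨i, j, hi, hj, rfl⟩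
  exact horbit i hi _ (zpow_mem hmem n) hn

/-- Contraction of a 1-dipole of color `0`.  Let `b ∈ B`, `w = σ_0 b`, and assume the
two endpoints of the color-`0` edge `(b, w)` lie in different `D`-bubbles of colors
`0̂`.  Let `G'` be the contracted graph on `B' = B \ {b}`, `W' = W \ {w}`, with
`σ'_0` the restriction of `σ_0` and, for `j ≠ 0`, `σ'_j x = σ_j x` if `σ_j x ≠ w` and
`σ'_j x = σ_j b` if `σ_j x = w`.  Then every jacket loses exactly `D - 1` faces, so its
Euler characteristic is unchanged, and the total number of faces drops by
`D(D-1)/2`. -/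
theorem one_dipole_contraction (D : ℕ) (hD : 2 ≤ D) (B W : Type)
    [Fintype B] [DecidableEq B] [Fintype W] [DecidableEq W]
    (σ : Fin (D + 1) → B ≃ W) (hp : 2 ≤ Fintype.card B) (b : B)
    (hdipole : ¬ ∃ g ∈ bubbleGroup σ 0, g b = (σ 1).symm (σ 0 b))
    (σ' : Fin (D + 1) → ({x : B // x ≠ b} ≃ {y : W // y ≠ σ 0 b}))
    (hσ'0 : ∀ x : {x : B // x ≠ b}, ((σ' 0 x : W) = σ 0 (x : B)))
    (hσ'j : ∀ j : Fin (D + 1), j ≠ 0 → ∀ x : {x : B // x ≠ b},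
      ((σ' j x : W) = if σ j (x : B) = σ 0 b then σ j b else σ j (x : B))) :
    (∀ τ : Equiv.Perm (Fin (D + 1)), IsFullCycle τ →
      (jacketFaces σ' τ : ℤ) = (jacketFaces σ τ : ℤ) - ((D : ℤ) - 1) ∧
      2 * ((Fintype.card B : ℤ) - 1) - (D + 1) * ((Fintype.card B : ℤ) - 1) +
          (jacketFaces σ' τ : ℤ) =
        2 * (Fintype.card B : ℤ) - (D + 1) * (Fintype.card B : ℤ) +
          (jacketFaces σ τ : ℤ)) ∧
    totalFaces σ' + D * (D - 1) / 2 = totalFaces σ := by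
  have key := fun (i j : Fin (D + 1)) (hne : i ≠ j) =>
    numCycles_facePerm_of_contraction hD σ b hdipole σ' hσ'0 hσ'j hne
  refine ⟨fun τ hτ => ?_, ?_⟩
  · have hfix : ∀ c, τ c ≠ c := fun c =>
      Equiv.Perm.mem_support.1 (hτ.2 ▸ Finset.mem_univ c)
    have hsum : jacketFaces σ τ =
        jacketFaces σ' τ + ∑ c : Fin (D + 1), (if c = 0 ∨ τ c = 0 then 0 else 1) := by
      rw [jacketFaces, jacketFaces, ← Finset.sum_add_distrib]
      exact Finset.sum_congr rfl fun c _ => (key c (τ c) (hfix c).symm).symm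
    have hcount := sum_ite_fixedPointFree (hfix 0)
    have hfaces : (jacketFaces σ' τ : ℤ) = (jacketFaces σ τ : ℤ) - ((D : ℤ) - 1) := by
      omega
    exact ⟨hfaces, by rw [hfaces]; ring⟩
  · rw [← card_filter_pos_lt, totalFaces, totalFaces, ← Finset.sum_add_distrib]
    exact Finset.sum_congr rfl fun p hp => key p.1 p.2 (Finset.mem_filter.1 hp).2.ne
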